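/- Let A be a bialgebra with a skew antipode (for example, a Hopf algebra with bijective antipode). Then for any left-right Hopf modules M and N over A and any n ≥ 1, the Hopf-module cohomology H^n(M,N) (total cohomology of the bicomplex C^{n,p}(M,N)) vanishes: H^n(M,N) = 0. -/

import Mathlib

open TensorProduct
noncomputable section

namespace PS

variable (k : Type) [Field k] (A : Type) [Ring A] [Bialgebra k A]

/-- Left-nested tensor powers with base `B`: `pwr B n = B ⊗ A ⊗ ⋯ ⊗ A` (`n` copies of `A`). -/
def pwr (B : ModuleCat k) : ℕ → ModuleCat k
  | 0 => B
  | n + 1 => ModuleCat.of k (pwr B n ⊗[k] A)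

/-- `A^{⊗ n}` realized as `pwr k n`, i.e. `k ⊗ A ⊗ ⋯ ⊗ A`. -/
abbrev Pk (n : ℕ) : ModuleCat k := pwr k A (ModuleCat.of k k) n

abbrev μA : A ⊗[k] A →ₗ[k] A := LinearMap.mul' k A
abbrev ΔA : A →ₗ[k] A ⊗[k] A := Coalgebra.comul
abbrev εA : A →ₗ[k] k := Coalgebra.counit

/-- Multiplication of the tensorands in slots `i` and `i+1` (`1 ≤ i ≤ n`);
junk (zero map) for other `i`. -/
def mulP : (n : ℕ) → (i : ℕ) → ((Pk k A (n+1) : Type) →ₗ[k] Pk k A n)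
  | 0, _ => 0
  | n + 1, i =>
      if i = n + 1 then
        (TensorProduct.map (LinearMap.id : (Pk k A n : Type) →ₗ[k] Pk k A n) (μA k A)).comp
          (TensorProduct.assoc k (Pk k A n) A A).toLinearMap
      else
        TensorProduct.map (mulP n i) (LinearMap.id : A →ₗ[k] A)

/-- Insert an `A`-factor at the innermost slot (slot 1). -/
def insP : (n : ℕ) → (A ⊗[k] (Pk k A n : Type)) ≃ₗ[k] (Pk k A (n+1) : Type)
  | 0 => TensorProduct.comm k A k
  | n + 1 =>
      (TensorProduct.assoc k A (Pk k A n) A).symm.trans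
        (TensorProduct.congr (insP n) (LinearEquiv.refl k A))

section NM

variable {N : Type} [AddCommGroup N] [Module k N]

/-- The left diagonal action of `A` on `N ⊗ A^{⊗ p}` built from a base action `ωN`. -/
def ldiag (ωN : A ⊗[k] N →ₗ[k] N) :
    (p : ℕ) → (A ⊗[k] (pwr k A (ModuleCat.of k N) p : Type) →ₗ[k] pwr k A (ModuleCat.of k N) p)
  | 0 => ωN
  | p + 1 =>
      (TensorProduct.map (ldiag ωN p) (μA k A)).comp <|
        ((TensorProduct.tensorTensorTensorComm k A A
            (pwr k A (ModuleCat.of k N) p : Type) A).toLinearMap).comp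
          (TensorProduct.map (ΔA k A) (LinearMap.id :
            ((pwr k A (ModuleCat.of k N) p : Type) ⊗[k] A) →ₗ[k] _))

/-- Right diagonal multiplication on the `A`-slots of `N ⊗ A^{⊗ p}` (counit on the base). -/
def rdiagE : (p : ℕ) →
    ((pwr k A (ModuleCat.of k N) p : Type) ⊗[k] A →ₗ[k] pwr k A (ModuleCat.of k N) p)
  | 0 => (TensorProduct.rid k N).toLinearMap.comp
      (TensorProduct.map (LinearMap.id : N →ₗ[k] N) (εA k A))
  | p + 1 =>
      (TensorProduct.map (rdiagE p) (μA k A)).comp <|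
        ((TensorProduct.tensorTensorTensorComm k
            (pwr k A (ModuleCat.of k N) p : Type) A A A).toLinearMap).comp
          (TensorProduct.map
            (LinearMap.id : ((pwr k A (ModuleCat.of k N) p : Type) ⊗[k] A) →ₗ[k] _) (ΔA k A))

/-- Right diagonal action on `N ⊗ A^{⊗ p}` built from a base (right) action `ωNr`. -/
def rdiagAct (ωNr : N ⊗[k] A →ₗ[k] N) : (p : ℕ) →
    ((pwr k A (ModuleCat.of k N) p : Type) ⊗[k] A →ₗ[k] pwr k A (ModuleCat.of k N) p)
  | 0 => ωNr
  | p + 1 =>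
      (TensorProduct.map (rdiagAct ωNr p) (μA k A)).comp <|
        ((TensorProduct.tensorTensorTensorComm k
            (pwr k A (ModuleCat.of k N) p : Type) A A A).toLinearMap).comp
          (TensorProduct.map
            (LinearMap.id : ((pwr k A (ModuleCat.of k N) p : Type) ⊗[k] A) →ₗ[k] _) (ΔA k A))

end NM

/-- `dL : A^{⊗ n} → A ⊗ A^{⊗ n}`, `a^1 ⊗ ⋯ ⊗ a^n ↦ Σ (a^1)_1 ⋯ (a^n)_1 ⊗ ((a^1)_2 ⊗ ⋯ ⊗ (a^n)_2)`. -/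
def dL : (n : ℕ) → ((Pk k A n : Type) →ₗ[k] A ⊗[k] (Pk k A n : Type))
  | 0 => (TensorProduct.map (Algebra.linearMap k A) (LinearMap.id : k →ₗ[k] k)).comp
      (TensorProduct.lid k k).symm.toLinearMap
  | n + 1 =>
      (TensorProduct.map (μA k A)
          (LinearMap.id : ((Pk k A n : Type) ⊗[k] A) →ₗ[k] _)).comp <|
        ((TensorProduct.tensorTensorTensorComm k A (Pk k A n : Type) A A).toLinearMap).comp
          (TensorProduct.map (dL n) (ΔA k A))

/-- `dR : A^{⊗ n} → A^{⊗ n} ⊗ A`, `a^1 ⊗ ⋯ ⊗ a^n ↦ Σ ((a^1)_1 ⊗ ⋯ ⊗ (a^n)_1) ⊗ (a^1)_2 ⋯ (a^n)_2`. -/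
def dR : (n : ℕ) → ((Pk k A n : Type) →ₗ[k] (Pk k A n : Type) ⊗[k] A)
  | 0 => (TensorProduct.map (LinearMap.id : k →ₗ[k] k) (Algebra.linearMap k A)).comp
      (TensorProduct.rid k k).symm.toLinearMap
  | n + 1 =>
      (TensorProduct.map
          (LinearMap.id : ((Pk k A n : Type) ⊗[k] A) →ₗ[k] _) (μA k A)).comp <|
        ((TensorProduct.tensorTensorTensorComm k (Pk k A n : Type) A A A).toLinearMap).comp
          (TensorProduct.map (dR n) (ΔA k A))

section Base

variable {N : Type} [AddCommGroup N] [Module k N]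

/-- Apply `ρN : N → N ⊗ A` to the base of `N ⊗ A^{⊗ p}`. -/
def rhoBase (ρN : N →ₗ[k] N ⊗[k] A) : (p : ℕ) →
    ((pwr k A (ModuleCat.of k N) p : Type) →ₗ[k] pwr k A (ModuleCat.of k (N ⊗[k] A)) p)
  | 0 => ρN
  | p + 1 => TensorProduct.map (rhoBase ρN p) (LinearMap.id : A →ₗ[k] A)

/-- Reinterpret `(N ⊗ A) ⊗ A^{⊗ p}` as `N ⊗ A^{⊗ (p+1)}`. -/
def shiftB : (p : ℕ) →
    ((pwr k A (ModuleCat.of k (N ⊗[k] A)) p : Type) ≃ₗ[k] pwr k A (ModuleCat.of k N) (p+1))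
  | 0 => LinearEquiv.refl k (N ⊗[k] A)
  | p + 1 => TensorProduct.congr (shiftB p) (LinearEquiv.refl k A)

/-- Multiply the `A`-component of the base `N ⊗ A` on the right by an element of `A`. -/
def rmulBase : (p : ℕ) →
    ((pwr k A (ModuleCat.of k (N ⊗[k] A)) p : Type) ⊗[k] A →ₗ[k]
      pwr k A (ModuleCat.of k (N ⊗[k] A)) p)
  | 0 => (TensorProduct.map (LinearMap.id : N →ₗ[k] N) (μA k A)).comp
      (TensorProduct.assoc k N A A).toLinearMap
  | p + 1 =>
      (TensorProduct.map (rmulBase p) (LinearMap.id : A →ₗ[k] A)).comp <|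
        ((TensorProduct.assoc k (pwr k A (ModuleCat.of k (N ⊗[k] A)) p : Type) A A).symm.toLinearMap).comp <|
          (TensorProduct.map
            (LinearMap.id : (pwr k A (ModuleCat.of k (N ⊗[k] A)) p : Type) →ₗ[k] _)
            (TensorProduct.comm k A A).toLinearMap).comp
            (TensorProduct.assoc k
              (pwr k A (ModuleCat.of k (N ⊗[k] A)) p : Type) A A).toLinearMap

/-- Apply the counit to the `A`-component of the base `N ⊗ A`. -/
def epsBase : (p : ℕ) →
    ((pwr k A (ModuleCat.of k (N ⊗[k] A)) p : Type) →ₗ[k] pwr k A (ModuleCat.of k N) p)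
  | 0 => (TensorProduct.rid k N).toLinearMap.comp
      (TensorProduct.map (LinearMap.id : N →ₗ[k] N) (εA k A))
  | p + 1 => TensorProduct.map (epsBase p) (LinearMap.id : A →ₗ[k] A)

/-- Apply `Δ` on the `i`-th `A`-slot (`1 ≤ i ≤ p`) of `N ⊗ A^{⊗ p}`; junk otherwise. -/
def comulAt : (p : ℕ) → (i : ℕ) →
    ((pwr k A (ModuleCat.of k N) p : Type) →ₗ[k] pwr k A (ModuleCat.of k N) (p+1))
  | 0, _ => 0
  | p + 1, i =>
      if i = p + 1 then
        ((TensorProduct.assoc k (pwr k A (ModuleCat.of k N) p : Type) A A).symm.toLinearMap).comp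
          (TensorProduct.map
            (LinearMap.id : (pwr k A (ModuleCat.of k N) p : Type) →ₗ[k] _) (ΔA k A))
      else
        TensorProduct.map (comulAt p i) (LinearMap.id : A →ₗ[k] A)

/-- Left coaction on `N ⊗ A^{⊗ p}` coming from a left coaction on the base. -/
def lcoBase (ρNl : N →ₗ[k] A ⊗[k] N) : (p : ℕ) →
    ((pwr k A (ModuleCat.of k N) p : Type) →ₗ[k]
      A ⊗[k] (pwr k A (ModuleCat.of k N) p : Type))
  | 0 => ρNl
  | p + 1 =>
      ((TensorProduct.assoc k A (pwr k A (ModuleCat.of k N) p : Type) A).toLinearMap).comp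
        (TensorProduct.map (lcoBase ρNl p) (LinearMap.id : A →ₗ[k] A))

end Base

section Bicomplex

variable {M N : Type} [AddCommGroup M] [Module k M] [AddCommGroup N] [Module k N]

/-- `A^{⊗ n} ⊗ M`, the domain of the `(n,p)` cochains. -/
abbrev Dm (M : Type) [AddCommGroup M] [Module k M] (n : ℕ) : Type :=
  (Pk k A n : Type) ⊗[k] M

/-- `N ⊗ A^{⊗ p}`. -/
abbrev Cd (N : Type) [AddCommGroup N] [Module k N] (p : ℕ) : Type :=
  (pwr k A (ModuleCat.of k N) p : Type)

/-- The space of `(n,p)` cochains `Hom(A^{⊗ n} ⊗ M, N ⊗ A^{⊗ p})`. -/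
abbrev Yc (M N : Type) [AddCommGroup M] [Module k M] [AddCommGroup N] [Module k N]
    (n p : ℕ) : Type := Dm k A M n →ₗ[k] Cd k A N p

variable (ωM : A ⊗[k] M →ₗ[k] M) (ρM : M →ₗ[k] M ⊗[k] A)
variable (ωN : A ⊗[k] N →ₗ[k] N) (ρN : N →ₗ[k] N ⊗[k] A)

/-- `b_0`: the face using the diagonal left action of `a^1` on `N ⊗ A^{⊗ p}`. -/
def face0 (n p : ℕ) (f : Yc k A M N n p) : Yc k A M N (n+1) p :=
  (ldiag k A ωN p).comp <|
    (TensorProduct.map (LinearMap.id : A →ₗ[k] A) f).comp <|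
      ((TensorProduct.assoc k A (Pk k A n : Type) M).toLinearMap).comp
        (TensorProduct.map (insP k A n).symm.toLinearMap (LinearMap.id : M →ₗ[k] M))

/-- `b_i`, `1 ≤ i ≤ n`: multiply the adjacent arguments `a^i a^{i+1}`. -/
def faceMid (n p : ℕ) (i : ℕ) (f : Yc k A M N n p) : Yc k A M N (n+1) p :=
  f.comp (TensorProduct.map (mulP k A n i) (LinearMap.id : M →ₗ[k] M))

/-- `b_{n+1}` in the Hopf-module case: `f(a^1 ⊗ ⋯ ⊗ a^n ⊗ a^{n+1}·m)`. -/
def faceLastH (n p : ℕ) (f : Yc k A M N n p) : Yc k A M N (n+1) p :=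
  f.comp <|
    (TensorProduct.map (LinearMap.id : (Pk k A n : Type) →ₗ[k] _) ωM).comp
      (TensorProduct.assoc k (Pk k A n : Type) A M).toLinearMap

/-- `b_{n+1}` in the Yetter-Drinfel'd case. -/
def faceLastYD (n p : ℕ) (f : Yc k A M N n p) : Yc k A M N (n+1) p :=
  (rdiagE k A p).comp <|
    ((TensorProduct.comm k A (Cd k A N p)).toLinearMap).comp <|
      (TensorProduct.map (LinearMap.id : A →ₗ[k] A)
        (f.comp (TensorProduct.map (LinearMap.id : (Pk k A n : Type) →ₗ[k] _) ωM))).comp <|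
        ((TensorProduct.leftComm k (Pk k A n : Type) A (A ⊗[k] M)).toLinearMap).comp <|
          (TensorProduct.map (LinearMap.id : (Pk k A n : Type) →ₗ[k] _)
            (TensorProduct.assoc k A A M).toLinearMap).comp <|
            ((TensorProduct.assoc k (Pk k A n : Type) (A ⊗[k] A) M).toLinearMap).comp
              (TensorProduct.map
                (TensorProduct.map (LinearMap.id : (Pk k A n : Type) →ₗ[k] _) (ΔA k A))
                (LinearMap.id : M →ₗ[k] M))

/-- The Yetter-Drinfel'd horizontal faces `b_i^{n,p}`, `0 ≤ i ≤ n+1`. -/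
def bYD (n p : ℕ) (i : ℕ) (f : Yc k A M N n p) : Yc k A M N (n+1) p :=
  if i = 0 then face0 k A ωN n p f
  else if i ≤ n then faceMid k A n p i f
  else faceLastYD k A ωM n p f

/-- The Hopf-module horizontal faces `b_i^{n,p}`, `0 ≤ i ≤ n+1`. -/
def bH (n p : ℕ) (i : ℕ) (f : Yc k A M N n p) : Yc k A M N (n+1) p :=
  if i = 0 then face0 k A ωN n p f
  else if i ≤ n then faceMid k A n p i f
  else faceLastH k A ωM n p f

/-- `c_0` in the Hopf-module case: apply `ρ_N` to the `N`-component of the output. -/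
def cof0H (n p : ℕ) (f : Yc k A M N n p) : Yc k A M N n (p+1) :=
  ((shiftB k A p).toLinearMap).comp ((rhoBase k A ρN p).comp f)

/-- `c_0` in the Yetter-Drinfel'd case. -/
def cof0YD (n p : ℕ) (f : Yc k A M N n p) : Yc k A M N n (p+1) :=
  ((shiftB k A p).toLinearMap).comp <|
    (rmulBase k A p).comp <|
      ((TensorProduct.comm k A
          (pwr k A (ModuleCat.of k (N ⊗[k] A)) p : Type)).toLinearMap).comp <|
        (TensorProduct.map (LinearMap.id : A →ₗ[k] A) ((rhoBase k A ρN p).comp f)).comp <|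
          ((TensorProduct.assoc k A (Pk k A n : Type) M).toLinearMap).comp
            (TensorProduct.map (dL k A n) (LinearMap.id : M →ₗ[k] M))

/-- `c_{p+1}`: uses the right comodule structure of `M`. -/
def cofLast (n p : ℕ) (f : Yc k A M N n p) : Yc k A M N n (p+1) :=
  (TensorProduct.map f (μA k A)).comp <|
    ((TensorProduct.tensorTensorTensorComm k (Pk k A n : Type) A M A).toLinearMap).comp
      (TensorProduct.map (dR k A n) ρM)

/-- The Yetter-Drinfel'd vertical cofaces `c_j^{n,p}`, `0 ≤ j ≤ p+1`. -/
def cYD (n p : ℕ) (j : ℕ) (f : Yc k A M N n p) : Yc k A M N n (p+1) :=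
  if j = 0 then cof0YD k A ρN n p f
  else if j ≤ p then (comulAt k A p j).comp f
  else cofLast k A ρM n p f

/-- The Hopf-module vertical cofaces `c_j^{n,p}`, `0 ≤ j ≤ p+1`. -/
def cH (n p : ℕ) (j : ℕ) (f : Yc k A M N n p) : Yc k A M N n (p+1) :=
  if j = 0 then cof0H k A ρN n p f
  else if j ≤ p then (comulAt k A p j).comp f
  else cofLast k A ρM n p f

/-- The horizontal differential (Yetter-Drinfel'd case). -/
def dmYD (n p : ℕ) (f : Yc k A M N n p) : Yc k A M N (n+1) p :=
  ∑ i ∈ Finset.range (n+2), ((-1 : ℤ)^i) • bYD k A ωM ωN n p i f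

/-- The vertical differential (Yetter-Drinfel'd case). -/
def dcYD (n p : ℕ) (f : Yc k A M N n p) : Yc k A M N n (p+1) :=
  ∑ j ∈ Finset.range (p+2), ((-1 : ℤ)^j) • cYD k A ρM ρN n p j f

/-- The horizontal differential (Hopf-module case). -/
def dmH (n p : ℕ) (f : Yc k A M N n p) : Yc k A M N (n+1) p :=
  ∑ i ∈ Finset.range (n+2), ((-1 : ℤ)^i) • bH k A ωM ωN n p i f

/-- The vertical differential (Hopf-module case). -/
def dcH (n p : ℕ) (f : Yc k A M N n p) : Yc k A M N n (p+1) :=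
  ∑ j ∈ Finset.range (p+2), ((-1 : ℤ)^j) • cH k A ρM ρN n p j f

end Bicomplex

section Structures

variable {M : Type} [AddCommGroup M] [Module k M]

/-- `(M, ωM)` is a left `A`-module. -/
def IsModule (ωM : A ⊗[k] M →ₗ[k] M) : Prop :=
  (∀ m : M, ωM ((1 : A) ⊗ₜ m) = m) ∧
  ∀ (a b : A) (m : M), ωM (a ⊗ₜ ωM (b ⊗ₜ m)) = ωM ((a * b) ⊗ₜ m)

/-- `(M, ρM)` is a right `A`-comodule. -/
def IsComodule (ρM : M →ₗ[k] M ⊗[k] A) : Prop :=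
  ((TensorProduct.rid k M).toLinearMap.comp
      ((TensorProduct.map (LinearMap.id : M →ₗ[k] M) (εA k A)).comp ρM) = LinearMap.id) ∧
  (TensorProduct.map ρM (LinearMap.id : A →ₗ[k] A)).comp ρM =
    ((TensorProduct.assoc k M A A).symm.toLinearMap).comp
      ((TensorProduct.map (LinearMap.id : M →ₗ[k] M) (ΔA k A)).comp ρM)

/-- The map `a ⊗ m ↦ Σ a_1·m_0 ⊗ a_2 m_1`. -/
def hopfRHS (ωM : A ⊗[k] M →ₗ[k] M) (ρM : M →ₗ[k] M ⊗[k] A) :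
    A ⊗[k] M →ₗ[k] M ⊗[k] A :=
  (TensorProduct.map ωM (μA k A)).comp <|
    ((TensorProduct.tensorTensorTensorComm k A A M A).toLinearMap).comp
      (TensorProduct.map (ΔA k A) ρM)

/-- The map `a ⊗ m ↦ Σ (a_2·m)_0 ⊗ (a_2·m)_1 a_1`. -/
def ydLHS (ωM : A ⊗[k] M →ₗ[k] M) (ρM : M →ₗ[k] M ⊗[k] A) :
    A ⊗[k] M →ₗ[k] M ⊗[k] A :=
  (TensorProduct.map (LinearMap.id : M →ₗ[k] M) (μA k A)).comp <|
    ((TensorProduct.assoc k M A A).toLinearMap).comp <|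
      ((TensorProduct.comm k A (M ⊗[k] A)).toLinearMap).comp <|
        (TensorProduct.map (LinearMap.id : A →ₗ[k] A) (ρM.comp ωM)).comp <|
          ((TensorProduct.assoc k A A M).toLinearMap).comp
            (TensorProduct.map (ΔA k A) (LinearMap.id : M →ₗ[k] M))

/-- `(M, ωM, ρM)` is a left-right Yetter-Drinfel'd module over `A`. -/
def IsYetterDrinfeld (ωM : A ⊗[k] M →ₗ[k] M) (ρM : M →ₗ[k] M ⊗[k] A) : Prop :=
  IsModule k A ωM ∧ IsComodule k A ρM ∧
    ydLHS k A ωM ρM = hopfRHS k A ωM ρM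

/-- `(M, ωM, ρM)` is a left-right Hopf module over `A`. -/
def IsHopfModule (ωM : A ⊗[k] M →ₗ[k] M) (ρM : M →ₗ[k] M ⊗[k] A) : Prop :=
  IsModule k A ωM ∧ IsComodule k A ρM ∧
    ρM.comp ωM = hopfRHS k A ωM ρM

end Structures


section Total

variable (k : Type) [Field k] (A : Type) [Ring A] [Bialgebra k A]
variable (M N : Type) [AddCommGroup M] [Module k M] [AddCommGroup N] [Module k N]
variable (ωM : A ⊗[k] M →ₗ[k] M) (ρM : M →ₗ[k] M ⊗[k] A)
variable (ωN : A ⊗[k] N →ₗ[k] N) (ρN : N →ₗ[k] N ⊗[k] A)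

/-- Degree-`q` part of the total complex of the Hopf-module bicomplex:
`⊕_{n+p=q} C^{n,p}(M,N)`. -/
def TotH (q : ℕ) : Type := ∀ (n p : ℕ), n + p = q → Yc k A M N n p

instance (q : ℕ) : Zero (TotH k A M N q) := ⟨fun _ _ _ => 0⟩

/-- The total differential `D = d_m + (-1)^n d_c`. -/
def DH (q : ℕ) (x : TotH k A M N q) : TotH k A M N (q+1) := fun n p h =>
  (match n, h with
    | 0, _ => 0
    | n'+1, h => dmH k A ωM ωN n' p (x n' p (by omega))) +
  (match p, h with
    | 0, _ => 0
    | p'+1, h => ((-1 : ℤ)^n) • dcH k A ρM ρN n p' (x n p' (by omega)))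

/-- `S` is a skew antipode for the bialgebra `A`:
`Σ S(a_2)a_1 = Σ a_2 S(a_1) = ε(a)1`. -/
def IsSkewAntipode (S : A →ₗ[k] A) : Prop :=
  (μA k A).comp ((TensorProduct.map S (LinearMap.id : A →ₗ[k] A)).comp
      (((TensorProduct.comm k A A).toLinearMap).comp (ΔA k A))) =
    (Algebra.linearMap k A).comp (εA k A) ∧
  (μA k A).comp ((TensorProduct.map (LinearMap.id : A →ₗ[k] A) S).comp
      (((TensorProduct.comm k A A).toLinearMap).comp (ΔA k A))) =
    (Algebra.linearMap k A).comp (εA k A)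

end Total

section Diagonal

variable {k A}
variable {X Y : Type} [AddCommGroup X] [Module k X] [AddCommGroup Y] [Module k Y]

/-- The diagonal action `a·(x ⊗ b) = Σ a_1·x ⊗ a_2 b` of `A` on `X ⊗ A`. -/
def diagAct (ℓ : A ⊗[k] X →ₗ[k] X) : A ⊗[k] (X ⊗[k] A) →ₗ[k] X ⊗[k] A :=
  (TensorProduct.map ℓ (μA k A)).comp <|
    ((TensorProduct.tensorTensorTensorComm k A A X A).toLinearMap).comp
      (TensorProduct.map (ΔA k A) LinearMap.id)

theorem diagAct_tmul (ℓ : A ⊗[k] X →ₗ[k] X) (a : A) (y : X ⊗[k] A) :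
    diagAct ℓ (a ⊗ₜ y) = TensorProduct.map ℓ (μA k A)
      (TensorProduct.tensorTensorTensorComm k A A X A (ΔA k A a ⊗ₜ y)) := by
  simp [diagAct]

theorem diagAct_assoc {ℓ : A ⊗[k] X →ₗ[k] X}
    (hℓ : ∀ (a b : A) (x : X), ℓ (a ⊗ₜ ℓ (b ⊗ₜ x)) = ℓ ((a * b) ⊗ₜ x)) (a b : A) (y : X ⊗[k] A) :
    diagAct ℓ (a ⊗ₜ diagAct ℓ (b ⊗ₜ y)) = diagAct ℓ ((a * b) ⊗ₜ y) := by
  simp only [diagAct_tmul, Bialgebra.comul_mul]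
  generalize ΔA k A a = z
  generalize ΔA k A b = w
  induction z using TensorProduct.induction_on with
  | zero => simp
  | add z z' hz hz' => simp only [add_tmul, add_mul, map_add, hz, hz']
  | tmul a₁ a₂ =>
    induction w using TensorProduct.induction_on with
    | zero => simp
    | add w w' hw hw' => simp only [add_tmul, tmul_add, mul_add, map_add, hw, hw']
    | tmul b₁ b₂ =>
      induction y using TensorProduct.induction_on with
      | zero => simp
      | add y y' hy hy' => simp only [tmul_add, map_add, hy, hy']
      | tmul x c => simp [hℓ, mul_assoc]

theorem diagAct_one {ℓ : A ⊗[k] X →ₗ[k] X} (hℓ : ∀ x : X, ℓ ((1 : A) ⊗ₜ x) = x)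
    (y : X ⊗[k] A) : diagAct ℓ ((1 : A) ⊗ₜ y) = y := by
  induction y using TensorProduct.induction_on with
  | zero => simp
  | add y y' hy hy' => simp only [tmul_add, map_add, hy, hy']
  | tmul x c => simp [diagAct_tmul, hℓ, Algebra.TensorProduct.one_def]

/-- Tensoring with `A` turns a map of modules into a map of diagonal modules. -/
theorem map_id_diagAct {ℓ : A ⊗[k] X →ₗ[k] X} {ℓ' : A ⊗[k] Y →ₗ[k] Y} {C : X →ₗ[k] Y}
    (hC : C ∘ₗ ℓ = ℓ' ∘ₗ TensorProduct.map LinearMap.id C) :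
    TensorProduct.map C LinearMap.id ∘ₗ diagAct ℓ =
      diagAct ℓ' ∘ₗ TensorProduct.map LinearMap.id (TensorProduct.map C LinearMap.id) := by
  have hC' (a : A) (x : X) : C (ℓ (a ⊗ₜ x)) = ℓ' (a ⊗ₜ C x) := by
    simpa using congr($hC (a ⊗ₜ x))
  ext a x b
  simp only [AlgebraTensorModule.curry_apply, curry_apply, LinearMap.coe_restrictScalars,
    LinearMap.comp_apply, diagAct_tmul, TensorProduct.map_tmul, LinearMap.id_apply]
  generalize ΔA k A a = z
  induction z using TensorProduct.induction_on with
  | zero => simp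
  | add z z' hz hz' => simp only [add_tmul, map_add, hz, hz']
  | tmul a₁ a₂ => simp [hC']

/-- Comultiplication of the last tensor factor is a map of diagonal modules. -/
theorem assoc_symm_map_comul_diagAct (ℓ : A ⊗[k] X →ₗ[k] X) :
    ((TensorProduct.assoc k X A A).symm.toLinearMap ∘ₗ
        TensorProduct.map LinearMap.id (ΔA k A)) ∘ₗ diagAct ℓ =
      diagAct (diagAct ℓ) ∘ₗ TensorProduct.map LinearMap.id
        ((TensorProduct.assoc k X A A).symm.toLinearMap ∘ₗ
          TensorProduct.map LinearMap.id (ΔA k A)) := by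
  ext a x b
  simp only [AlgebraTensorModule.curry_apply, curry_apply, LinearMap.coe_restrictScalars,
    LinearMap.comp_apply, diagAct_tmul, TensorProduct.map_tmul, LinearMap.id_apply,
    LinearEquiv.coe_coe]
  have h1 : ∀ z : A ⊗[k] A, (TensorProduct.assoc k X A A).symm (TensorProduct.map LinearMap.id
      (ΔA k A) (TensorProduct.map ℓ (μA k A)
        (TensorProduct.tensorTensorTensorComm k A A X A (z ⊗ₜ (x ⊗ₜ b))))) =
      (TensorProduct.assoc k X A A).symm (TensorProduct.map (ℓ ∘ₗ (TensorProduct.mk k A X).flip x)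
        (LinearMap.mulRight k (ΔA k A b)) (TensorProduct.map LinearMap.id (ΔA k A) z)) := by
    intro z
    induction z using TensorProduct.induction_on with
    | zero => simp
    | add z z' hz hz' => simp only [add_tmul, map_add, hz, hz']
    | tmul a₁ a₂ => simp
  have h2 : ∀ (w z : A ⊗[k] A), TensorProduct.map (diagAct ℓ) (μA k A)
        (TensorProduct.tensorTensorTensorComm k A A (X ⊗[k] A) A
          (z ⊗ₜ (TensorProduct.assoc k X A A).symm (x ⊗ₜ w))) =
      (TensorProduct.assoc k X A A).symm (TensorProduct.map (ℓ ∘ₗ (TensorProduct.mk k A X).flip x)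
        (LinearMap.mulRight k w)
        (TensorProduct.assoc k A A A (TensorProduct.map (ΔA k A) LinearMap.id z))) := by
    intro w z
    induction z using TensorProduct.induction_on with
    | zero => simp
    | add z z' hz hz' => simp only [add_tmul, map_add, hz, hz']
    | tmul a₁ a₂ =>
      simp only [TensorProduct.map_tmul, LinearMap.id_apply]
      induction w using TensorProduct.induction_on with
      | zero => simp
      | add w w' hw hw' =>
        have hadd : LinearMap.mulRight k (w + w') =
            LinearMap.mulRight k w + LinearMap.mulRight k w' := by
          ext; simp [mul_add]
        simp only [tmul_add, map_add, hw, hw', hadd, TensorProduct.map_add_right,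
          LinearMap.add_apply]
      | tmul b₁ b₂ =>
        simp only [TensorProduct.assoc_symm_tmul, tensorTensorTensorComm_tmul,
          TensorProduct.map_tmul, diagAct_tmul]
        generalize ΔA k A a₁ = y
        induction y using TensorProduct.induction_on with
        | zero => simp
        | add y y' hy hy' => simp only [add_tmul, map_add, hy, hy']
        | tmul c₁ c₂ => simp
  rw [h1, h2]
  have := Coalgebra.coassoc_apply (R := k) a
  simp only [LinearMap.rTensor, LinearMap.lTensor] at this
  rw [this]

end Diagonal

section Coinvariants

variable {k A}
variable {M X : Type} [AddCommGroup M] [Module k M] [AddCommGroup X] [Module k X]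

/-- The map `m ↦ Σ φ(m_1)·g(m_0)`. -/
def starAct (ρ : M →ₗ[k] M ⊗[k] A) (ω : A ⊗[k] X →ₗ[k] X) (φ : A →ₗ[k] A) (g : M →ₗ[k] X) :
    M →ₗ[k] X :=
  (ω ∘ₗ (TensorProduct.comm k X A).toLinearMap ∘ₗ TensorProduct.map g φ) ∘ₗ ρ

theorem starAct_starAct {ρ : M →ₗ[k] M ⊗[k] A} (hρ : IsComodule k A ρ)
    {ω : A ⊗[k] X →ₗ[k] X} (hω : ∀ (a b : A) (x : X), ω (a ⊗ₜ ω (b ⊗ₜ x)) = ω ((a * b) ⊗ₜ x))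
    (ψ φ : A →ₗ[k] A) (g : M →ₗ[k] X) :
    starAct ρ ω ψ (starAct ρ ω φ g) =
      starAct ρ ω (μA k A ∘ₗ TensorProduct.map ψ φ ∘ₗ
        (TensorProduct.comm k A A).toLinearMap ∘ₗ ΔA k A) g := by
  have key : (ω ∘ₗ (TensorProduct.comm k X A).toLinearMap ∘ₗ
        TensorProduct.map (ω ∘ₗ (TensorProduct.comm k X A).toLinearMap ∘ₗ
          TensorProduct.map g φ) ψ) ∘ₗ (TensorProduct.assoc k M A A).symm.toLinearMap =
      ω ∘ₗ (TensorProduct.comm k X A).toLinearMap ∘ₗ TensorProduct.map g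
        (μA k A ∘ₗ TensorProduct.map ψ φ ∘ₗ (TensorProduct.comm k A A).toLinearMap) := by
    ext m a b
    simp [hω]
  ext m
  have h1 := congr($(hρ.2) m)
  have h2 := congr($key (TensorProduct.map LinearMap.id (ΔA k A) (ρ m)))
  simp only [LinearMap.comp_apply, LinearEquiv.coe_coe] at h1 h2
  rw [← h1] at h2
  simp only [starAct, LinearMap.comp_apply, LinearEquiv.coe_coe]
  rw [← LinearMap.comp_apply (TensorProduct.map _ _),
    ← LinearMap.comp_apply (TensorProduct.map _ _), ← TensorProduct.map_comp, ← TensorProduct.map_comp] at h2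
  simpa [LinearMap.comp_assoc] using h2

theorem starAct_counit {ρ : M →ₗ[k] M ⊗[k] A} (hρ : IsComodule k A ρ)
    {ω : A ⊗[k] X →ₗ[k] X} (hω : ∀ x : X, ω ((1 : A) ⊗ₜ x) = x) (g : M →ₗ[k] X) :
    starAct ρ ω (Algebra.linearMap k A ∘ₗ εA k A) g = g := by
  have key : ω ∘ₗ (TensorProduct.comm k X A).toLinearMap ∘ₗ
        TensorProduct.map g (Algebra.linearMap k A ∘ₗ εA k A) =
      g ∘ₗ (TensorProduct.rid k M).toLinearMap ∘ₗ TensorProduct.map LinearMap.id (εA k A) := by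
    ext m a
    simp [Algebra.algebraMap_eq_smul_one, hω]
  rw [starAct, key, LinearMap.comp_assoc, LinearMap.comp_assoc, hρ.1, LinearMap.comp_id]

/-- The projection `m ↦ Σ S(m_1)·m_0` of a left-right Hopf module onto its coinvariants. -/
def coinvProj (S : A →ₗ[k] A) (ω : A ⊗[k] M →ₗ[k] M) (ρ : M →ₗ[k] M ⊗[k] A) : M →ₗ[k] M :=
  starAct ρ ω S LinearMap.id

variable {S : A →ₗ[k] A} {ω : A ⊗[k] M →ₗ[k] M} {ρ : M →ₗ[k] M ⊗[k] A}

theorem starAct_id_coinvProj (hS : IsSkewAntipode k A S) (h : IsHopfModule k A ω ρ) :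
    starAct ρ ω LinearMap.id (coinvProj S ω ρ) = LinearMap.id := by
  rw [coinvProj, starAct_starAct h.2.1 h.1.2, hS.2, starAct_counit h.2.1 h.1.1]

theorem hopfRHS_eq (ω : A ⊗[k] M →ₗ[k] M) (ρ : M →ₗ[k] M ⊗[k] A) :
    hopfRHS k A ω ρ = diagAct ω ∘ₗ TensorProduct.map LinearMap.id ρ := by
  simp only [hopfRHS, diagAct, LinearMap.comp_assoc, ← TensorProduct.map_comp, LinearMap.id_comp,
    LinearMap.comp_id]

theorem comp_starAct {Y : Type} [AddCommGroup Y] [Module k Y] {ωX : A ⊗[k] X →ₗ[k] X}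
    {ωY : A ⊗[k] Y →ₗ[k] Y} {f : X →ₗ[k] Y}
    (hf : f ∘ₗ ωX = ωY ∘ₗ TensorProduct.map LinearMap.id f)
    (φ : A →ₗ[k] A) (g : M →ₗ[k] X) :
    f ∘ₗ starAct ρ ωX φ g = starAct ρ ωY φ (f ∘ₗ g) := by
  have hf' (a : A) (x : X) : f (ωX (a ⊗ₜ x)) = ωY (a ⊗ₜ f x) := by
    simpa using congr($hf (a ⊗ₜ x))
  simp only [starAct, ← LinearMap.comp_assoc]
  congr 1
  ext m a
  simp [hf']

theorem starAct_diagAct (hρ : IsComodule k A ρ) (ω : A ⊗[k] X →ₗ[k] X) (g : M →ₗ[k] X) :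
    starAct ρ (diagAct ω) LinearMap.id ((TensorProduct.mk k X A).flip 1 ∘ₗ g) =
      TensorProduct.map (starAct ρ ω LinearMap.id g) LinearMap.id ∘ₗ ρ := by
  have key : diagAct ω ∘ₗ (TensorProduct.comm k (X ⊗[k] A) A).toLinearMap ∘ₗ
        TensorProduct.map ((TensorProduct.mk k X A).flip 1 ∘ₗ g) LinearMap.id =
      TensorProduct.map (ω ∘ₗ (TensorProduct.comm k X A).toLinearMap ∘ₗ
        TensorProduct.map g LinearMap.id) LinearMap.id ∘ₗ
        (TensorProduct.assoc k M A A).symm.toLinearMap ∘ₗ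
          TensorProduct.map LinearMap.id (ΔA k A) := by
    ext m a
    simp only [AlgebraTensorModule.curry_apply, curry_apply, LinearMap.coe_restrictScalars,
      LinearMap.comp_apply, TensorProduct.map_tmul, LinearMap.id_apply, LinearEquiv.coe_coe,
      TensorProduct.comm_tmul, diagAct_tmul]
    generalize ΔA k A a = z
    induction z using TensorProduct.induction_on with
    | zero => simp
    | add z z' hz hz' => simp only [add_tmul, tmul_add, map_add, hz, hz']
    | tmul a₁ a₂ => simp
  rw [starAct, key, starAct, LinearMap.comp_assoc, LinearMap.comp_assoc, ← hρ.2,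
    ← LinearMap.comp_assoc, ← TensorProduct.map_comp, LinearMap.comp_id]

theorem rho_coinvProj (hS : IsSkewAntipode k A S) (h : IsHopfModule k A ω ρ) (m : M) :
    ρ (coinvProj S ω ρ m) = coinvProj S ω ρ m ⊗ₜ 1 := by
  have hρ : starAct ρ (diagAct ω) LinearMap.id
      ((TensorProduct.mk k M A).flip 1 ∘ₗ coinvProj S ω ρ) = ρ := by
    rw [starAct_diagAct h.2.1, starAct_id_coinvProj hS h, TensorProduct.map_id, LinearMap.id_comp]
  have : ρ ∘ₗ coinvProj S ω ρ = (TensorProduct.mk k M A).flip 1 ∘ₗ coinvProj S ω ρ := by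
    rw [coinvProj, comp_starAct (h.2.2.trans (hopfRHS_eq ω ρ)), LinearMap.comp_id]
    calc starAct ρ (diagAct ω) S ρ
        = starAct ρ (diagAct ω) S (starAct ρ (diagAct ω) LinearMap.id
            ((TensorProduct.mk k M A).flip 1 ∘ₗ coinvProj S ω ρ)) := by rw [hρ]
      _ = (TensorProduct.mk k M A).flip 1 ∘ₗ coinvProj S ω ρ := by
        rw [starAct_starAct h.2.1 (diagAct_assoc h.1.2), hS.1,
          starAct_counit h.2.1 (diagAct_one h.1.1)]
  simpa using congr($this m)

theorem rho_omega (h : IsHopfModule k A ω ρ) (a : A) (m : M) :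
    ρ (ω (a ⊗ₜ m)) = diagAct ω (a ⊗ₜ ρ m) := by
  simpa using congr($(h.2.2.trans (hopfRHS_eq ω ρ)) (a ⊗ₜ m))

theorem coinvProj_omega_of_coinv (hS : IsSkewAntipode k A S) (h : IsHopfModule k A ω ρ)
    {v : M} (hv : ρ v = v ⊗ₜ 1) (b : A) :
    coinvProj S ω ρ (ω (b ⊗ₜ v)) = εA k A b • v := by
  have key : ∀ z : A ⊗[k] A, ω (TensorProduct.comm k M A (TensorProduct.map LinearMap.id S
      (TensorProduct.map ω (μA k A)
        (TensorProduct.tensorTensorTensorComm k A A M A (z ⊗ₜ (v ⊗ₜ 1)))))) =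
      ω ((μA k A (TensorProduct.map S LinearMap.id (TensorProduct.comm k A A z))) ⊗ₜ v) := by
    intro z
    induction z using TensorProduct.induction_on with
    | zero => simp
    | add z z' hz hz' => simp only [add_tmul, map_add, hz, hz']
    | tmul a₁ a₂ => simp [h.1.2]
  have hb := congr($(hS.1) b)
  simp only [LinearMap.comp_apply, LinearEquiv.coe_coe] at hb
  simp only [coinvProj, starAct, LinearMap.comp_apply, LinearEquiv.coe_coe, rho_omega h, hv,
    diagAct_tmul]
  rw [key, hb]
  simp [Algebra.algebraMap_eq_smul_one, ← smul_tmul', h.1.1]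

/-- The map `m ⊗ a ↦ a·P(m)`, with `P` the projection onto the coinvariants. -/
def coinvSection (S : A →ₗ[k] A) (ω : A ⊗[k] M →ₗ[k] M) (ρ : M →ₗ[k] M ⊗[k] A) :
    M ⊗[k] A →ₗ[k] M :=
  ω ∘ₗ (TensorProduct.comm k M A).toLinearMap ∘ₗ
    TensorProduct.map (coinvProj S ω ρ) LinearMap.id

theorem coinvSection_comp_rho (hS : IsSkewAntipode k A S) (h : IsHopfModule k A ω ρ) :
    coinvSection S ω ρ ∘ₗ ρ = LinearMap.id :=
  starAct_id_coinvProj hS h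

theorem coinvProj_omega (hS : IsSkewAntipode k A S) (h : IsHopfModule k A ω ρ) (a : A) (m : M) :
    coinvProj S ω ρ (ω (a ⊗ₜ m)) = εA k A a • coinvProj S ω ρ m := by
  have key : ∀ z : M ⊗[k] A, coinvProj S ω ρ (ω (a ⊗ₜ coinvSection S ω ρ z)) =
      εA k A a • coinvProj S ω ρ (TensorProduct.rid k M
        (TensorProduct.map LinearMap.id (εA k A) z)) := by
    intro z
    induction z using TensorProduct.induction_on with
    | zero => simp
    | add z z' hz hz' => simp only [tmul_add, map_add, smul_add, hz, hz']
    | tmul n c =>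
      simp [coinvSection, h.1.2, coinvProj_omega_of_coinv hS h (rho_coinvProj hS h n), mul_smul]
  have h1 := congr($(coinvSection_comp_rho hS h) m)
  have h2 := congr($(h.2.1.1) m)
  simp only [LinearMap.comp_apply, LinearEquiv.coe_coe, LinearMap.id_apply] at h1 h2
  simpa only [h1, h2] using key (ρ m)

theorem rho_comp_coinvSection (hS : IsSkewAntipode k A S) (h : IsHopfModule k A ω ρ) :
    ρ ∘ₗ coinvSection S ω ρ = TensorProduct.map (coinvSection S ω ρ) LinearMap.id ∘ₗ
      (TensorProduct.assoc k M A A).symm.toLinearMap ∘ₗ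
        TensorProduct.map LinearMap.id (ΔA k A) := by
  ext m a
  simp only [coinvSection, AlgebraTensorModule.curry_apply, curry_apply,
    LinearMap.coe_restrictScalars, LinearMap.comp_apply, TensorProduct.map_tmul,
    LinearMap.id_apply, LinearEquiv.coe_coe, TensorProduct.comm_tmul, rho_omega h,
    rho_coinvProj hS h, diagAct_tmul]
  generalize ΔA k A a = z
  induction z using TensorProduct.induction_on with
  | zero => simp
  | add z z' hz hz' => simp only [add_tmul, tmul_add, map_add, hz, hz']
  | tmul a₁ a₂ => simp

/-- The map `m ↦ Σ m_1 ⊗ P(m_0)`, with `P` the projection onto the coinvariants. -/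
def freeSection (S : A →ₗ[k] A) (ω : A ⊗[k] M →ₗ[k] M) (ρ : M →ₗ[k] M ⊗[k] A) :
    M →ₗ[k] A ⊗[k] M :=
  (TensorProduct.comm k M A).toLinearMap ∘ₗ
    TensorProduct.map (coinvProj S ω ρ) LinearMap.id ∘ₗ ρ

theorem omega_comp_freeSection (hS : IsSkewAntipode k A S) (h : IsHopfModule k A ω ρ) :
    ω ∘ₗ freeSection S ω ρ = LinearMap.id :=
  starAct_id_coinvProj hS h

theorem freeSection_omega (hS : IsSkewAntipode k A S) (h : IsHopfModule k A ω ρ) (a : A) (m : M) :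
    freeSection S ω ρ (ω (a ⊗ₜ m)) =
      TensorProduct.map (LinearMap.mulLeft k a) LinearMap.id (freeSection S ω ρ m) := by
  have key : ∀ (y : M ⊗[k] A) (z : A ⊗[k] A), TensorProduct.comm k M A
      (TensorProduct.map (coinvProj S ω ρ) LinearMap.id (TensorProduct.map ω (μA k A)
        (TensorProduct.tensorTensorTensorComm k A A M A (z ⊗ₜ y)))) =
      TensorProduct.map (LinearMap.mulLeft k
        (TensorProduct.lid k A (TensorProduct.map (εA k A) LinearMap.id z))) LinearMap.id
        (TensorProduct.comm k M A (TensorProduct.map (coinvProj S ω ρ) LinearMap.id y)) := by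
    intro y z
    induction y using TensorProduct.induction_on with
    | zero => simp
    | add y y' hy hy' => simp only [tmul_add, map_add, hy, hy']
    | tmul n c =>
      induction z using TensorProduct.induction_on with
      | zero => simp
      | add z z' hz hz' => simp only [add_tmul, map_add, hz, hz']; simp [add_mul, add_tmul]
      | tmul a₁ a₂ => simp [coinvProj_omega hS h, smul_tmul]
  have ha : TensorProduct.lid k A (TensorProduct.map (εA k A) LinearMap.id (ΔA k A a)) = a := by
    have := Coalgebra.rTensor_counit_comul (R := k) a
    rw [LinearMap.rTensor] at this
    rw [this]; simp
  simp only [freeSection, LinearMap.comp_apply, LinearEquiv.coe_coe, rho_omega h, diagAct_tmul]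
  rw [key, ha]

theorem codiag_freeSection (hS : IsSkewAntipode k A S) (h : IsHopfModule k A ω ρ) :
    TensorProduct.map LinearMap.id (μA k A) ∘ₗ
        (TensorProduct.tensorTensorTensorComm k A A M A).toLinearMap ∘ₗ
          TensorProduct.map (ΔA k A) ρ ∘ₗ freeSection S ω ρ =
      TensorProduct.map (freeSection S ω ρ) LinearMap.id ∘ₗ ρ := by
  have key : TensorProduct.map LinearMap.id (μA k A) ∘ₗ
        (TensorProduct.tensorTensorTensorComm k A A M A).toLinearMap ∘ₗ
          TensorProduct.map (ΔA k A) ρ ∘ₗ (TensorProduct.comm k M A).toLinearMap ∘ₗ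
            TensorProduct.map (coinvProj S ω ρ) LinearMap.id =
      TensorProduct.map ((TensorProduct.comm k M A).toLinearMap ∘ₗ
        TensorProduct.map (coinvProj S ω ρ) LinearMap.id) LinearMap.id ∘ₗ
        (TensorProduct.assoc k M A A).symm.toLinearMap ∘ₗ
          TensorProduct.map LinearMap.id (ΔA k A) := by
    ext m a
    simp only [AlgebraTensorModule.curry_apply, curry_apply, LinearMap.coe_restrictScalars,
      LinearMap.comp_apply, TensorProduct.map_tmul, LinearMap.id_apply, LinearEquiv.coe_coe,
      TensorProduct.comm_tmul, rho_coinvProj hS h]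
    generalize ΔA k A a = z
    induction z using TensorProduct.induction_on with
    | zero => simp
    | add z z' hz hz' => simp only [add_tmul, tmul_add, map_add, hz, hz']
    | tmul a₁ a₂ => simp
  have key' := congr($key ∘ₗ ρ)
  simp only [LinearMap.comp_assoc, ← h.2.1.2] at key'
  rw [freeSection, key', ← LinearMap.comp_assoc, ← TensorProduct.map_comp]
  simp only [LinearMap.comp_assoc, LinearMap.comp_id]

end Coinvariants

section Homotopy

variable {k A}
variable {M N : Type} [AddCommGroup M] [Module k M] [AddCommGroup N] [Module k N]

theorem ldiag_assoc {ω : A ⊗[k] N →ₗ[k] N} (hω : IsModule k A ω) :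
    ∀ (p : ℕ) (a b : A) (x : Cd k A N p),
      ldiag k A ω p (a ⊗ₜ ldiag k A ω p (b ⊗ₜ x)) = ldiag k A ω p ((a * b) ⊗ₜ x)
  | 0 => hω.2
  | p + 1 => diagAct_assoc (ldiag_assoc hω p)

theorem shiftB_rhoBase_succ (ρ : N →ₗ[k] N ⊗[k] A) (p : ℕ) :
    (shiftB k A (p + 1)).toLinearMap ∘ₗ rhoBase k A ρ (p + 1) =
      TensorProduct.map ((shiftB k A p).toLinearMap ∘ₗ rhoBase k A ρ p) LinearMap.id := by
  exact (TensorProduct.map_comp _ _ _ _).symm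

theorem rhoBase_ldiag {ω : A ⊗[k] N →ₗ[k] N} {ρ : N →ₗ[k] N ⊗[k] A}
    (h : IsHopfModule k A ω ρ) : ∀ p : ℕ,
    ((shiftB k A p).toLinearMap ∘ₗ rhoBase k A ρ p) ∘ₗ ldiag k A ω p =
      ldiag k A ω (p + 1) ∘ₗ TensorProduct.map LinearMap.id
        ((shiftB k A p).toLinearMap ∘ₗ rhoBase k A ρ p)
  | 0 => h.2.2.trans (hopfRHS_eq ω ρ)
  | p + 1 => by
    rw [shiftB_rhoBase_succ]
    exact map_id_diagAct (rhoBase_ldiag h p)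

theorem comulAt_last (p : ℕ) : comulAt k A (N := N) (p + 1) (p + 1) =
    (TensorProduct.assoc k (Cd k A N p) A A).symm.toLinearMap ∘ₗ
      TensorProduct.map LinearMap.id (ΔA k A) :=
  if_pos rfl

theorem comulAt_of_ne {p i : ℕ} (hi : i ≠ p + 1) : comulAt k A (N := N) (p + 1) i =
    TensorProduct.map (comulAt k A (N := N) p i) LinearMap.id :=
  if_neg hi

theorem comulAt_ldiag (ω : A ⊗[k] N →ₗ[k] N) : ∀ p i : ℕ,
    comulAt k A p i ∘ₗ ldiag k A ω p =
      ldiag k A ω (p + 1) ∘ₗ TensorProduct.map LinearMap.id (comulAt k A p i)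
  | 0, i => by simp [comulAt]
  | p + 1, i => by
    by_cases hi : i = p + 1
    · subst hi
      rw [comulAt_last]
      exact assoc_symm_map_comul_diagAct (ldiag k A ω p)
    · rw [comulAt_of_ne hi]
      exact map_id_diagAct (comulAt_ldiag ω p i)

/-- Apply `s : N ⊗ A → N` to the innermost factors of `N ⊗ A^{⊗ (p+1)}`. -/
def contractBase (s : N ⊗[k] A →ₗ[k] N) : (p : ℕ) → (Cd k A N (p + 1) →ₗ[k] Cd k A N p)
  | 0 => s
  | p + 1 => TensorProduct.map (contractBase s p) (LinearMap.id : A →ₗ[k] A)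

theorem contractBase_rhoBase {s : N ⊗[k] A →ₗ[k] N} {ρ : N →ₗ[k] N ⊗[k] A}
    (hs : s ∘ₗ ρ = LinearMap.id) : ∀ p : ℕ,
    contractBase s p ∘ₗ (shiftB k A p).toLinearMap ∘ₗ rhoBase k A ρ p = LinearMap.id
  | 0 => hs
  | p + 1 => by
    rw [shiftB_rhoBase_succ]
    have := contractBase_rhoBase hs p
    refine (TensorProduct.map_comp _ _ _ _).symm.trans ?_
    rw [this]
    exact TensorProduct.map_id

theorem contractBase_comulAt_one {s : N ⊗[k] A →ₗ[k] N} {ρ : N →ₗ[k] N ⊗[k] A}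
    (hs : ρ ∘ₗ s = TensorProduct.map s LinearMap.id ∘ₗ
      (TensorProduct.assoc k N A A).symm.toLinearMap ∘ₗ
        TensorProduct.map LinearMap.id (ΔA k A)) : ∀ p : ℕ,
    contractBase s (p + 1) ∘ₗ comulAt k A (p + 1) 1 =
      ((shiftB k A p).toLinearMap ∘ₗ rhoBase k A ρ p) ∘ₗ contractBase s p
  | 0 => by
    rw [comulAt_last]
    exact hs.symm
  | p + 1 => by
    rw [shiftB_rhoBase_succ, comulAt_of_ne (by omega)]
    have := contractBase_comulAt_one hs p
    refine (TensorProduct.map_comp _ _ _ _).symm.trans ?_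
    rw [this]
    exact TensorProduct.map_comp _ _ _ _

theorem contractBase_comulAt (s : N ⊗[k] A →ₗ[k] N) : ∀ {p i : ℕ}, 1 ≤ i → i ≤ p →
    contractBase s (p + 1) ∘ₗ comulAt k A (p + 1) (i + 1) =
      comulAt k A p i ∘ₗ contractBase s p
  | 0, i, h1, h2 => by omega
  | p + 1, i, h1, h2 => by
    by_cases hi : i = p + 1
    · subst hi
      rw [comulAt_last, comulAt_last]
      change TensorProduct.map (TensorProduct.map (contractBase s p) LinearMap.id) LinearMap.id ∘ₗ
        (TensorProduct.assoc k (Cd k A N (p + 1)) A A).symm.toLinearMap ∘ₗ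
          TensorProduct.map LinearMap.id (ΔA k A) =
        ((TensorProduct.assoc k (Cd k A N p) A A).symm.toLinearMap ∘ₗ
          TensorProduct.map LinearMap.id (ΔA k A)) ∘ₗ
          TensorProduct.map (contractBase s p) LinearMap.id
      ext x a
      simp only [AlgebraTensorModule.curry_apply, curry_apply, LinearMap.coe_restrictScalars,
        LinearMap.comp_apply, TensorProduct.map_tmul, LinearMap.id_apply, LinearEquiv.coe_coe]
      generalize ΔA k A a = z
      induction z using TensorProduct.induction_on with
      | zero => simp
      | add z z' hz hz' => simp only [tmul_add, map_add, hz, hz']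
      | tmul a₁ a₂ => simp
    · rw [comulAt_of_ne hi, comulAt_of_ne (by omega)]
      have := contractBase_comulAt s (p := p) h1 (by omega)
      refine (TensorProduct.map_comp _ _ _ _).symm.trans ?_
      rw [this]
      exact TensorProduct.map_comp _ _ _ _

/-- The vertical contracting homotopy. -/
def colHtpy (s : N ⊗[k] A →ₗ[k] N) (n p : ℕ) : Yc k A M N n (p + 1) →ₗ[k] Yc k A M N n p :=
  LinearMap.llcomp k _ _ _ (contractBase s p)

theorem colHtpy_apply (s : N ⊗[k] A →ₗ[k] N) (n p : ℕ) (f : Yc k A M N n (p + 1)) :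
    colHtpy s n p f = contractBase s p ∘ₗ f := rfl

theorem colHtpy_dcH {s : N ⊗[k] A →ₗ[k] N} {ρM : M →ₗ[k] M ⊗[k] A} {ρN : N →ₗ[k] N ⊗[k] A}
    (hs : s ∘ₗ ρN = LinearMap.id)
    (hs' : ρN ∘ₗ s = TensorProduct.map s LinearMap.id ∘ₗ
      (TensorProduct.assoc k N A A).symm.toLinearMap ∘ₗ
        TensorProduct.map LinearMap.id (ΔA k A)) (n p : ℕ) (f : Yc k A M N n (p + 1)) :
    colHtpy s n (p + 1) (dcH k A ρM ρN n (p + 1) f) =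
      f - dcH k A ρM ρN n p (colHtpy s n p f) := by
  have h0 : colHtpy s n (p + 1) (cH k A ρM ρN n (p + 1) 0 f) = f := by
    rw [colHtpy_apply, cH, if_pos rfl, cof0H, ← LinearMap.comp_assoc, ← LinearMap.comp_assoc,
      LinearMap.comp_assoc _ _ (contractBase s (p + 1)), contractBase_rhoBase hs, LinearMap.id_comp]
  have h1 : ∀ j ∈ Finset.range (p + 2), colHtpy s n (p + 1) (cH k A ρM ρN n (p + 1) (j + 1) f) =
      cH k A ρM ρN n p j (colHtpy s n p f) := by
    intro j hj
    rw [Finset.mem_range] at hj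
    rw [colHtpy_apply, colHtpy_apply, cH, cH, if_neg (by omega)]
    rcases Nat.eq_zero_or_pos j with h2 | h2
    · rw [if_pos (by omega), if_pos h2, h2, cof0H, ← LinearMap.comp_assoc,
        contractBase_comulAt_one hs']
      rfl
    · rw [if_neg (by omega : j ≠ 0)]
      by_cases h3 : j ≤ p
      · rw [if_pos (by omega), if_pos h3, ← LinearMap.comp_assoc, contractBase_comulAt s h2 h3]
        rfl
      · rw [if_neg (by omega), if_neg h3, cofLast, cofLast, ← LinearMap.comp_assoc]
        exact congrArg (fun g => LinearMap.comp g
          ((TensorProduct.tensorTensorTensorComm k (Pk k A n) A M A).toLinearMap ∘ₗ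
            TensorProduct.map (dR k A n) ρM)) (TensorProduct.map_comp _ _ _ _).symm
  rw [dcH, map_sum, Finset.sum_range_succ', dcH, sub_eq_add_neg, add_comm f,
    ← Finset.sum_neg_distrib]
  congr 1
  · refine Finset.sum_congr rfl fun j hj => ?_
    rw [map_zsmul, h1 j hj, pow_succ, mul_neg_one, neg_smul]
  · rw [map_zsmul, h0, pow_zero, one_smul]

/-- The horizontal contracting homotopy, up to sign. -/
def rowHtpy (t : M →ₗ[k] A ⊗[k] M) (n p : ℕ) : Yc k A M N (n + 1) p →ₗ[k] Yc k A M N n p :=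
  LinearMap.lcomp k _ ((TensorProduct.assoc k (Pk k A n) A M).symm.toLinearMap ∘ₗ
    TensorProduct.map LinearMap.id t)

theorem codiag_section {U Y : Type} [AddCommGroup U] [Module k U] [AddCommGroup Y] [Module k Y]
    {t : M →ₗ[k] A ⊗[k] M} {ρ : M →ₗ[k] M ⊗[k] A}
    (ht : TensorProduct.map LinearMap.id (μA k A) ∘ₗ
        (TensorProduct.tensorTensorTensorComm k A A M A).toLinearMap ∘ₗ
          TensorProduct.map (ΔA k A) ρ ∘ₗ t = TensorProduct.map t LinearMap.id ∘ₗ ρ)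
    (δ : U →ₗ[k] U ⊗[k] A) (f : (U ⊗[k] A) ⊗[k] M →ₗ[k] Y) :
    (TensorProduct.map f (μA k A) ∘ₗ
        (TensorProduct.tensorTensorTensorComm k (U ⊗[k] A) A M A).toLinearMap ∘ₗ
          TensorProduct.map (TensorProduct.map LinearMap.id (μA k A) ∘ₗ
            (TensorProduct.tensorTensorTensorComm k U A A A).toLinearMap ∘ₗ
              TensorProduct.map δ (ΔA k A)) ρ) ∘ₗ
        (TensorProduct.assoc k U A M).symm.toLinearMap ∘ₗ TensorProduct.map LinearMap.id t =
      TensorProduct.map (f ∘ₗ (TensorProduct.assoc k U A M).symm.toLinearMap ∘ₗ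
          TensorProduct.map LinearMap.id t) (μA k A) ∘ₗ
        (TensorProduct.tensorTensorTensorComm k U A M A).toLinearMap ∘ₗ
          TensorProduct.map δ ρ := by
  have key : ∀ (d : U ⊗[k] A) (z : A ⊗[k] A) (y : M ⊗[k] A),
      TensorProduct.map f (μA k A)
        (TensorProduct.tensorTensorTensorComm k (U ⊗[k] A) A M A
          (TensorProduct.map LinearMap.id (μA k A)
            (TensorProduct.tensorTensorTensorComm k U A A A (d ⊗ₜ z)) ⊗ₜ y)) =
      TensorProduct.map (f ∘ₗ (TensorProduct.assoc k U A M).symm.toLinearMap) (μA k A)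
        (TensorProduct.tensorTensorTensorComm k U A (A ⊗[k] M) A (d ⊗ₜ
          TensorProduct.map LinearMap.id (μA k A)
            (TensorProduct.tensorTensorTensorComm k A A M A (z ⊗ₜ y)))) := by
    intro d z y
    induction y using TensorProduct.induction_on with
    | zero => simp
    | add y y' hy hy' => simp only [tmul_add, map_add, hy, hy']
    | tmul m c =>
      induction z using TensorProduct.induction_on with
      | zero => simp
      | add z z' hz hz' => simp only [add_tmul, tmul_add, map_add, hz, hz']
      | tmul a₁ a₂ =>
        induction d using TensorProduct.induction_on with
        | zero => simp
        | add d d' hd hd' => simp only [add_tmul, map_add, hd, hd']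
        | tmul u b => simp [mul_assoc]
  have key₁ : ∀ (u : U) (w : A ⊗[k] M),
      TensorProduct.map f (μA k A)
        (TensorProduct.tensorTensorTensorComm k (U ⊗[k] A) A M A
          (TensorProduct.map (TensorProduct.map LinearMap.id (μA k A) ∘ₗ
            (TensorProduct.tensorTensorTensorComm k U A A A).toLinearMap ∘ₗ
              TensorProduct.map δ (ΔA k A)) ρ ((TensorProduct.assoc k U A M).symm (u ⊗ₜ w)))) =
      TensorProduct.map (f ∘ₗ (TensorProduct.assoc k U A M).symm.toLinearMap) (μA k A)
        (TensorProduct.tensorTensorTensorComm k U A (A ⊗[k] M) A (δ u ⊗ₜ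
          TensorProduct.map LinearMap.id (μA k A)
            (TensorProduct.tensorTensorTensorComm k A A M A
              (TensorProduct.map (ΔA k A) ρ w)))) := by
    intro u w
    induction w using TensorProduct.induction_on with
    | zero => simp
    | add w w' hw hw' => simp only [tmul_add, map_add, hw, hw']
    | tmul a m => simpa using key (δ u) (ΔA k A a) (ρ m)
  have key₂ : ∀ (d : U ⊗[k] A) (y : M ⊗[k] A),
      TensorProduct.map (f ∘ₗ (TensorProduct.assoc k U A M).symm.toLinearMap) (μA k A)
        (TensorProduct.tensorTensorTensorComm k U A (A ⊗[k] M) A (d ⊗ₜ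
          TensorProduct.map t LinearMap.id y)) =
      TensorProduct.map (f ∘ₗ (TensorProduct.assoc k U A M).symm.toLinearMap ∘ₗ
          TensorProduct.map LinearMap.id t) (μA k A)
        (TensorProduct.tensorTensorTensorComm k U A M A (d ⊗ₜ y)) := by
    intro d y
    induction y using TensorProduct.induction_on with
    | zero => simp
    | add y y' hy hy' => simp only [tmul_add, map_add, hy, hy']
    | tmul m c =>
      induction d using TensorProduct.induction_on with
      | zero => simp
      | add d d' hd hd' => simp only [add_tmul, map_add, hd, hd']
      | tmul u b => simp
  ext u m
  have hm := congr($ht m)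
  simp only [LinearMap.comp_apply, LinearEquiv.coe_coe] at hm
  simp only [AlgebraTensorModule.curry_apply, curry_apply,
    LinearMap.coe_restrictScalars, LinearMap.comp_apply, TensorProduct.map_tmul,
    LinearMap.id_apply, LinearEquiv.coe_coe]
  exact (key₁ u (t m)).trans (by rw [hm, key₂])

theorem rowHtpy_dcH {t : M →ₗ[k] A ⊗[k] M} {ρM : M →ₗ[k] M ⊗[k] A}
    (ht : TensorProduct.map LinearMap.id (μA k A) ∘ₗ
        (TensorProduct.tensorTensorTensorComm k A A M A).toLinearMap ∘ₗ
          TensorProduct.map (ΔA k A) ρM ∘ₗ t = TensorProduct.map t LinearMap.id ∘ₗ ρM)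
    (ρN : N →ₗ[k] N ⊗[k] A) (n p : ℕ) (f : Yc k A M N (n + 1) p) :
    rowHtpy t n (p + 1) (dcH k A ρM ρN (n + 1) p f) = dcH k A ρM ρN n p (rowHtpy t n p f) := by
  rw [dcH, dcH, map_sum]
  refine Finset.sum_congr rfl fun j _ => ?_
  rw [map_zsmul]
  congr 1
  unfold cH
  split_ifs
  · rfl
  · rfl
  · exact codiag_section ht (dR k A n) f

theorem insertion_section {U W Y Z : Type} [AddCommGroup U] [Module k U] [AddCommGroup W]
    [Module k W] [AddCommGroup Y] [Module k Y] [AddCommGroup Z] [Module k Z]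
    (t : M →ₗ[k] A ⊗[k] M) (E : A ⊗[k] W ≃ₗ[k] U) (ℓ : A ⊗[k] Y →ₗ[k] Z)
    (f : (W ⊗[k] A) ⊗[k] M →ₗ[k] Y) :
    (ℓ ∘ₗ TensorProduct.map LinearMap.id f ∘ₗ
        (TensorProduct.assoc k A (W ⊗[k] A) M).toLinearMap ∘ₗ
          TensorProduct.map ((TensorProduct.assoc k A W A).symm.trans
            (TensorProduct.congr E (LinearEquiv.refl k A))).symm.toLinearMap LinearMap.id) ∘ₗ
        (TensorProduct.assoc k U A M).symm.toLinearMap ∘ₗ TensorProduct.map LinearMap.id t =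
      ℓ ∘ₗ TensorProduct.map LinearMap.id (f ∘ₗ
          (TensorProduct.assoc k W A M).symm.toLinearMap ∘ₗ TensorProduct.map LinearMap.id t) ∘ₗ
        (TensorProduct.assoc k A W M).toLinearMap ∘ₗ
          TensorProduct.map E.symm.toLinearMap LinearMap.id := by
  refine TensorProduct.ext' fun x m => ?_
  obtain ⟨v, rfl⟩ := E.surjective x
  simp only [LinearMap.comp_apply, LinearEquiv.coe_coe, TensorProduct.map_tmul,
    LinearMap.id_apply, LinearEquiv.symm_apply_apply]
  induction v using TensorProduct.induction_on with
  | zero => simp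
  | add v v' hv hv' => simp only [add_tmul, map_add, hv, hv']
  | tmul a w =>
    simp only [TensorProduct.assoc_tmul, TensorProduct.map_tmul, LinearMap.comp_apply,
      LinearEquiv.coe_coe, LinearMap.id_apply]
    generalize t m = z
    induction z using TensorProduct.induction_on with
    | zero => simp
    | add z z' hz hz' => simp only [tmul_add, map_add, hz, hz']
    | tmul b m => simp

theorem rowHtpy_face0_succ (t : M →ₗ[k] A ⊗[k] M) (ω : A ⊗[k] N →ₗ[k] N) (n p : ℕ)
    (f : Yc k A M N (n + 1) p) :
    rowHtpy t (n + 1) p (face0 k A ω (n + 1) p f) = face0 k A ω n p (rowHtpy t n p f) :=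
  insertion_section t (insP k A n) (ldiag k A ω p) f

theorem map_map_id_section {U W Y : Type} [AddCommGroup U] [Module k U] [AddCommGroup W]
    [Module k W] [AddCommGroup Y] [Module k Y] (t : M →ₗ[k] A ⊗[k] M) (g : U →ₗ[k] W)
    (f : (W ⊗[k] A) ⊗[k] M →ₗ[k] Y) :
    (f ∘ₗ TensorProduct.map (TensorProduct.map g LinearMap.id) LinearMap.id) ∘ₗ
        (TensorProduct.assoc k U A M).symm.toLinearMap ∘ₗ TensorProduct.map LinearMap.id t =
      (f ∘ₗ (TensorProduct.assoc k W A M).symm.toLinearMap ∘ₗ TensorProduct.map LinearMap.id t) ∘ₗ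
        TensorProduct.map g LinearMap.id := by
  refine TensorProduct.ext' fun u m => ?_
  simp only [LinearMap.comp_apply, LinearEquiv.coe_coe, TensorProduct.map_tmul,
    LinearMap.id_apply]
  generalize t m = z
  induction z using TensorProduct.induction_on with
  | zero => simp
  | add z z' hz hz' => simp only [tmul_add, map_add, hz, hz']
  | tmul b m => simp

theorem rowHtpy_faceMid (t : M →ₗ[k] A ⊗[k] M) {n p i : ℕ} (hi : i ≠ n + 1)
    (f : Yc k A M N (n + 1) p) :
    rowHtpy t (n + 1) p (faceMid k A (n + 1) p i f) = faceMid k A n p i (rowHtpy t n p f) := by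
  have h : mulP k A (n + 1) i = TensorProduct.map (mulP k A n i) LinearMap.id := if_neg hi
  rw [faceMid, h]
  exact map_map_id_section t (mulP k A n i) f

theorem mul_section {W Y : Type} [AddCommGroup W] [Module k W] [AddCommGroup Y] [Module k Y]
    {t : M →ₗ[k] A ⊗[k] M} {ω : A ⊗[k] M →ₗ[k] M}
    (ht : ∀ a m, t (ω (a ⊗ₜ m)) = TensorProduct.map (LinearMap.mulLeft k a) LinearMap.id (t m))
    (f : (W ⊗[k] A) ⊗[k] M →ₗ[k] Y) :
    (f ∘ₗ TensorProduct.map (TensorProduct.map LinearMap.id (μA k A) ∘ₗ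
          (TensorProduct.assoc k W A A).toLinearMap) LinearMap.id) ∘ₗ
        (TensorProduct.assoc k (W ⊗[k] A) A M).symm.toLinearMap ∘ₗ
          TensorProduct.map LinearMap.id t =
      (f ∘ₗ (TensorProduct.assoc k W A M).symm.toLinearMap ∘ₗ TensorProduct.map LinearMap.id t) ∘ₗ
        TensorProduct.map LinearMap.id ω ∘ₗ (TensorProduct.assoc k W A M).toLinearMap := by
  refine TensorProduct.ext' fun u m => ?_
  induction u using TensorProduct.induction_on with
  | zero => simp
  | add u u' hu hu' => simp only [add_tmul, map_add, hu, hu']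
  | tmul w a =>
    simp only [LinearMap.comp_apply, LinearEquiv.coe_coe, TensorProduct.map_tmul,
      LinearMap.id_apply, TensorProduct.assoc_tmul, ht]
    generalize t m = z
    induction z using TensorProduct.induction_on with
    | zero => simp
    | add z z' hz hz' => simp only [tmul_add, map_add, hz, hz']
    | tmul b m => simp

theorem rowHtpy_faceMid_last {t : M →ₗ[k] A ⊗[k] M} {ω : A ⊗[k] M →ₗ[k] M}
    (ht : ∀ a m, t (ω (a ⊗ₜ m)) = TensorProduct.map (LinearMap.mulLeft k a) LinearMap.id (t m))
    (n p : ℕ) (f : Yc k A M N (n + 1) p) :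
    rowHtpy t (n + 1) p (faceMid k A (n + 1) p (n + 1) f) =
      faceLastH k A ω n p (rowHtpy t n p f) := by
  have h : mulP k A (n + 1) (n + 1) = (TensorProduct.map LinearMap.id (μA k A)).comp
      (TensorProduct.assoc k (Pk k A n) A A).toLinearMap := if_pos rfl
  rw [faceMid, h]
  exact mul_section ht f

theorem rowHtpy_faceLastH {t : M →ₗ[k] A ⊗[k] M} {ω : A ⊗[k] M →ₗ[k] M}
    (ht : ω ∘ₗ t = LinearMap.id) (n p : ℕ) (f : Yc k A M N n p) :
    rowHtpy t n p (faceLastH k A ω n p f) = f := by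
  refine TensorProduct.ext' fun x m => ?_
  have hm : ω (t m) = m := congr($ht m)
  change f (TensorProduct.map LinearMap.id ω (TensorProduct.assoc k (Pk k A n) A M
    ((TensorProduct.assoc k (Pk k A n) A M).symm (x ⊗ₜ t m)))) = f (x ⊗ₜ m)
  rw [LinearEquiv.apply_symm_apply, TensorProduct.map_tmul, hm, LinearMap.id_apply]

theorem rowHtpy_dmH_succ {t : M →ₗ[k] A ⊗[k] M} {ωM : A ⊗[k] M →ₗ[k] M}
    (ht : ωM ∘ₗ t = LinearMap.id)
    (ht' : ∀ a m, t (ωM (a ⊗ₜ m)) = TensorProduct.map (LinearMap.mulLeft k a) LinearMap.id (t m))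
    (ωN : A ⊗[k] N →ₗ[k] N) (n p : ℕ) (f : Yc k A M N (n + 1) p) :
    rowHtpy t (n + 1) p (dmH k A ωM ωN (n + 1) p f) =
      dmH k A ωM ωN n p (rowHtpy t n p f) + ((-1 : ℤ) ^ n) • f := by
  rw [dmH, Finset.sum_range_succ, map_add, dmH, map_sum]
  congr 1
  · refine Finset.sum_congr rfl fun i hi => ?_
    rw [Finset.mem_range] at hi
    rw [map_zsmul]
    congr 1
    unfold bH
    split_ifs with h0 h1 h2 h2
    · exact rowHtpy_face0_succ t ωN n p f
    · exact rowHtpy_faceMid t (by omega) f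
    · obtain rfl : i = n + 1 := by omega
      exact rowHtpy_faceMid_last ht' n p f
    · omega
    · omega
  · rw [bH, if_neg (by omega), if_neg (by omega), map_zsmul, rowHtpy_faceLastH ht]
    congr 1
    ring

theorem dmH_zero (ωM : A ⊗[k] M →ₗ[k] M) (ωN : A ⊗[k] N →ₗ[k] N) (p : ℕ) (f : Yc k A M N 0 p) :
    dmH k A ωM ωN 0 p f = face0 k A ωN 0 p f - faceLastH k A ωM 0 p f := by
  simp [dmH, Finset.sum_range_succ, bH, sub_eq_add_neg]

/-- The averaging operator `f ↦ (m ↦ Σ t'·f(t''))` on `0`-cochains in the horizontal direction,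
where `t(m) = Σ t' ⊗ t''`. -/
def average (t : M →ₗ[k] A ⊗[k] M) (ω : A ⊗[k] N →ₗ[k] N) (p : ℕ) (f : Yc k A M N 0 p) :
    Yc k A M N 0 p :=
  rowHtpy t 0 p (face0 k A ω 0 p f)

theorem rowHtpy_dmH_zero {t : M →ₗ[k] A ⊗[k] M} {ωM : A ⊗[k] M →ₗ[k] M}
    (ht : ωM ∘ₗ t = LinearMap.id) (ωN : A ⊗[k] N →ₗ[k] N) (p : ℕ) (f : Yc k A M N 0 p) :
    rowHtpy t 0 p (dmH k A ωM ωN 0 p f) = average t ωN p f - f := by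
  rw [dmH_zero, map_sub, rowHtpy_faceLastH ht, average]

theorem face0_average_aux {Y : Type} [AddCommGroup Y] [Module k Y]
    {t : M →ₗ[k] A ⊗[k] M} {ω : A ⊗[k] M →ₗ[k] M}
    (ht : ∀ a m, t (ω (a ⊗ₜ m)) = TensorProduct.map (LinearMap.mulLeft k a) LinearMap.id (t m))
    {ℓ : A ⊗[k] Y →ₗ[k] Y}
    (hℓ : ∀ (a b : A) (x : Y), ℓ (a ⊗ₜ ℓ (b ⊗ₜ x)) = ℓ ((a * b) ⊗ₜ x))
    (f g : k ⊗[k] M →ₗ[k] Y)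
    (hg : g = (ℓ ∘ₗ TensorProduct.map LinearMap.id f ∘ₗ
      (TensorProduct.assoc k A k M).toLinearMap ∘ₗ
        TensorProduct.map (TensorProduct.comm k A k).symm.toLinearMap LinearMap.id) ∘ₗ
      (TensorProduct.assoc k k A M).symm.toLinearMap ∘ₗ TensorProduct.map LinearMap.id t) :
    ℓ ∘ₗ TensorProduct.map LinearMap.id g ∘ₗ (TensorProduct.assoc k A k M).toLinearMap ∘ₗ
        TensorProduct.map (TensorProduct.comm k A k).symm.toLinearMap LinearMap.id =
      g ∘ₗ TensorProduct.map LinearMap.id ω ∘ₗ (TensorProduct.assoc k k A M).toLinearMap := by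
  refine TensorProduct.ext_threefold fun c a m => ?_
  simp only [hg, LinearMap.comp_apply, LinearEquiv.coe_coe, TensorProduct.map_tmul,
    LinearMap.id_apply, TensorProduct.assoc_tmul, TensorProduct.comm_symm_tmul, ht]
  generalize t m = z
  induction z using TensorProduct.induction_on with
  | zero => simp
  | add z z' hz hz' => simp only [tmul_add, map_add, hz, hz']
  | tmul b m => simp [hℓ]

theorem dmH_average {t : M →ₗ[k] A ⊗[k] M} {ωM : A ⊗[k] M →ₗ[k] M}
    (ht : ∀ a m, t (ωM (a ⊗ₜ m)) = TensorProduct.map (LinearMap.mulLeft k a) LinearMap.id (t m))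
    {ωN : A ⊗[k] N →ₗ[k] N} (hN : IsModule k A ωN) (p : ℕ) (f : Yc k A M N 0 p) :
    dmH k A ωM ωN 0 p (average t ωN p f) = 0 := by
  rw [dmH_zero, sub_eq_zero]
  exact face0_average_aux ht (ldiag_assoc hN p) f _ rfl

theorem face0_add (ω : A ⊗[k] N →ₗ[k] N) (n p : ℕ) (f g : Yc k A M N n p) :
    face0 k A ω n p (f + g) = face0 k A ω n p f + face0 k A ω n p g := by
  simp only [face0, TensorProduct.map_add_right, LinearMap.add_comp, LinearMap.comp_add]

/-- The horizontal differential as an additive map. -/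
def dmHom (ωM : A ⊗[k] M →ₗ[k] M) (ωN : A ⊗[k] N →ₗ[k] N) (n p : ℕ) :
    Yc k A M N n p →+ Yc k A M N (n + 1) p :=
  AddMonoidHom.mk' (dmH k A ωM ωN n p) fun f g => by
    simp only [dmH, ← Finset.sum_add_distrib, ← smul_add]
    refine Finset.sum_congr rfl fun i _ => congrArg _ ?_
    unfold bH
    split_ifs
    · exact face0_add ωN n p f g
    · exact LinearMap.add_comp _ _ _
    · exact LinearMap.add_comp _ _ _

/-- The vertical differential as an additive map. -/
def dcHom (ρM : M →ₗ[k] M ⊗[k] A) (ρN : N →ₗ[k] N ⊗[k] A) (n p : ℕ) :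
    Yc k A M N n p →+ Yc k A M N n (p + 1) :=
  AddMonoidHom.mk' (dcH k A ρM ρN n p) fun f g => by
    simp only [dcH, ← Finset.sum_add_distrib, ← smul_add]
    refine Finset.sum_congr rfl fun i _ => congrArg _ ?_
    unfold cH
    split_ifs
    · simp only [cof0H, LinearMap.comp_add]
    · exact LinearMap.comp_add _ _ _
    · simp only [cofLast, TensorProduct.map_add_left, LinearMap.add_comp]
      rfl

theorem cofLast_face0_aux {Y : Type} [AddCommGroup Y] [Module k Y] (ℓ : A ⊗[k] Y →ₗ[k] Y)
    (ρ : M →ₗ[k] M ⊗[k] A) (f : k ⊗[k] M →ₗ[k] Y) :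
    diagAct ℓ ∘ₗ TensorProduct.map LinearMap.id (TensorProduct.map f (μA k A) ∘ₗ
          (TensorProduct.tensorTensorTensorComm k k A M A).toLinearMap ∘ₗ
            TensorProduct.map (dR k A 0) ρ) ∘ₗ
        (TensorProduct.assoc k A k M).toLinearMap ∘ₗ
          TensorProduct.map (TensorProduct.comm k A k).symm.toLinearMap LinearMap.id =
      TensorProduct.map (ℓ ∘ₗ TensorProduct.map LinearMap.id f ∘ₗ
          (TensorProduct.assoc k A k M).toLinearMap ∘ₗ
            TensorProduct.map (TensorProduct.comm k A k).symm.toLinearMap LinearMap.id) (μA k A) ∘ₗ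
        (TensorProduct.tensorTensorTensorComm k (k ⊗[k] A) A M A).toLinearMap ∘ₗ
          TensorProduct.map (dR k A 1) ρ := by
  have h0 (c : k) : dR k A 0 c = c ⊗ₜ[k] (1 : A) := by
    change TensorProduct.map LinearMap.id (Algebra.linearMap k A)
      ((TensorProduct.rid k k).symm c) = _
    simp
  have h1 (c : k) (a : A) : dR k A 1 (c ⊗ₜ[k] a) =
      TensorProduct.map (TensorProduct.mk k k A c) LinearMap.id (ΔA k A a) := by
    change TensorProduct.map LinearMap.id (μA k A)
      (TensorProduct.tensorTensorTensorComm k k A A A (dR k A 0 c ⊗ₜ ΔA k A a)) = _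
    rw [h0]
    generalize ΔA k A a = z
    induction z using TensorProduct.induction_on with
    | zero => simp
    | add z z' hz hz' => simp only [tmul_add, map_add, hz, hz']
    | tmul a₁ a₂ => simp
  refine TensorProduct.ext_threefold fun c a m => ?_
  simp only [LinearMap.comp_apply]
  refine Eq.trans ?_ (congrArg (fun z => TensorProduct.map _ _
    (TensorProduct.tensorTensorTensorComm k (k ⊗[k] A) A M A (z ⊗ₜ ρ m))) (h1 c a).symm)
  refine (congrArg (fun z => diagAct ℓ (a ⊗ₜ TensorProduct.map f (μA k A)
    (TensorProduct.tensorTensorTensorComm k k A M A (z ⊗ₜ ρ m)))) (h0 c)).trans ?_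
  rw [diagAct_tmul]
  generalize ΔA k A a = z
  generalize ρ m = y
  induction y using TensorProduct.induction_on with
  | zero => simp
  | add y y' hy hy' => simp only [tmul_add, map_add, hy, hy']
  | tmul n b =>
    induction z using TensorProduct.induction_on with
    | zero => simp
    | add z z' hz hz' => simp only [add_tmul, map_add, hz, hz']
    | tmul a₁ a₂ => simp

theorem face0_comp {ω : A ⊗[k] N →ₗ[k] N} {p p' : ℕ} {C : Cd k A N p →ₗ[k] Cd k A N p'}
    (hC : C ∘ₗ ldiag k A ω p = ldiag k A ω p' ∘ₗ TensorProduct.map LinearMap.id C)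
    (n : ℕ) (f : Yc k A M N n p) :
    face0 k A ω n p' (C ∘ₗ f) = C ∘ₗ face0 k A ω n p f := by
  rw [face0, face0, ← LinearMap.comp_assoc _ _ C, hC, LinearMap.comp_assoc,
    ← LinearMap.comp_assoc _ _ (TensorProduct.map LinearMap.id C), ← TensorProduct.map_comp,
    LinearMap.id_comp]

theorem face0_dcH {ρM : M →ₗ[k] M ⊗[k] A} {ωN : A ⊗[k] N →ₗ[k] N} {ρN : N →ₗ[k] N ⊗[k] A}
    (hN : IsHopfModule k A ωN ρN) (p : ℕ) (f : Yc k A M N 0 p) :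
    face0 k A ωN 0 (p + 1) (dcH k A ρM ρN 0 p f) = dcH k A ρM ρN 1 p (face0 k A ωN 0 p f) := by
  have hsum := map_sum (AddMonoidHom.mk' (face0 k A (M := M) ωN 0 (p + 1)) (face0_add ωN 0 (p + 1)))
    (fun j => ((-1 : ℤ) ^ j) • cH k A ρM ρN 0 p j f) (Finset.range (p + 2))
  refine hsum.trans (Finset.sum_congr rfl fun j _ => ?_)
  rw [map_zsmul]
  refine congrArg _ ?_
  change face0 k A ωN 0 (p + 1) (cH k A ρM ρN 0 p j f) = _
  unfold cH
  split_ifs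
  · exact face0_comp (rhoBase_ldiag hN p) 0 f
  · exact face0_comp (comulAt_ldiag ωN p j) 0 f
  · exact cofLast_face0_aux (ldiag k A ωN p) ρM f

theorem dcH_average {t : M →ₗ[k] A ⊗[k] M} {ρM : M →ₗ[k] M ⊗[k] A}
    (ht : TensorProduct.map LinearMap.id (μA k A) ∘ₗ
        (TensorProduct.tensorTensorTensorComm k A A M A).toLinearMap ∘ₗ
          TensorProduct.map (ΔA k A) ρM ∘ₗ t = TensorProduct.map t LinearMap.id ∘ₗ ρM)
    {ωN : A ⊗[k] N →ₗ[k] N} {ρN : N →ₗ[k] N ⊗[k] A} (hN : IsHopfModule k A ωN ρN)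
    (p : ℕ) (f : Yc k A M N 0 p) :
    dcH k A ρM ρN 0 p (average t ωN p f) = average t ωN (p + 1) (dcH k A ρM ρN 0 p f) := by
  rw [average, average, ← rowHtpy_dcH ht, face0_dcH hN]

end Homotopy

/-- If the bialgebra `A` has a skew antipode (e.g. a Hopf algebra with
bijective antipode), then for any left-right Hopf modules `M, N` over `A` and any
`n ≥ 1`, `H^n(M,N) = 0`: every cocycle of the total complex of the Hopf-module
bicomplex is a coboundary. -/
theorem Hn_vanishes_of_skewAntipode (k : Type) [Field k] (A : Type) [Ring A]
    [Bialgebra k A] (S : A →ₗ[k] A) (hS : IsSkewAntipode k A S)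
    (M N : Type) [AddCommGroup M] [Module k M] [AddCommGroup N] [Module k N]
    (ωM : A ⊗[k] M →ₗ[k] M) (ρM : M →ₗ[k] M ⊗[k] A)
    (ωN : A ⊗[k] N →ₗ[k] N) (ρN : N →ₗ[k] N ⊗[k] A)
    (hM : IsHopfModule k A ωM ρM) (hN : IsHopfModule k A ωN ρN)
    (q : ℕ) (x : TotH k A M N (q+1))
    (hx : DH k A M N ωM ρM ωN ρN (q+1) x = 0) :
    ∃ y : TotH k A M N q, DH k A M N ωM ρM ωN ρN q y = x := by
  have ht₁ := omega_comp_freeSection hS hM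
  have ht₂ := freeSection_omega hS hM
  have ht₃ := codiag_freeSection hS hM
  have hs₁ := coinvSection_comp_rho hS hN
  have hs₂ := rho_comp_coinvSection hS hN
  set t := freeSection S ωM ρM
  set s := coinvSection S ωN ρN
  let y : TotH k A M N q := fun n p h =>
    ((-1 : ℤ) ^ (n + 1)) • rowHtpy t n p (x (n + 1) p (by omega)) +
      match n, h with
      | 0, h => average t ωN p (colHtpy s 0 p (x 0 (p + 1) (by omega)))
      | _ + 1, _ => 0
  have hdm (n p : ℕ) (h : n + p = q) : dmH k A ωM ωN n p (y n p h) =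
      ((-1 : ℤ) ^ (n + 1)) • dmH k A ωM ωN n p (rowHtpy t n p (x (n + 1) p (by omega))) := by
    refine (map_add (dmHom ωM ωN n p) _ _).trans ?_
    rw [map_zsmul]
    match n, h with
    | 0, h => exact (congrArg _ (dmH_average ht₂ hN.1 p _)).trans (add_zero _)
    | n + 1, h => exact (congrArg _ (map_zero (dmHom ωM ωN (n + 1) p))).trans (add_zero _)
  have hdc (n p : ℕ) (h : n + 1 + p = q) : dcH k A ρM ρN (n + 1) p (y (n + 1) p h) =
      ((-1 : ℤ) ^ (n + 2)) • dcH k A ρM ρN (n + 1) p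
        (rowHtpy t (n + 1) p (x (n + 2) p (by omega))) := by
    refine (congrArg _ (add_zero _)).trans ?_
    exact map_zsmul (dcHom ρM ρN (n + 1) p) _ _
  refine ⟨y, ?_⟩
  funext n p h
  match n, p, h with
  | 0, 0, h => omega
  | 0, p + 1, h =>
    have hx₀ : dcH k A ρM ρN 0 (p + 1) (x 0 (p + 1) h) = 0 := by
      have : 0 + ((-1 : ℤ) ^ 0) • dcH k A ρM ρN 0 (p + 1) (x 0 (p + 1) h) = 0 :=
        congrFun (congrFun (congrFun hx 0) (p + 2)) (by omega)
      simpa using this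
    have hx₁ : dmH k A ωM ωN 0 (p + 1) (x 0 (p + 1) h) =
        dcH k A ρM ρN 1 p (x 1 p (by omega)) := by
      have : dmH k A ωM ωN 0 (p + 1) (x 0 (p + 1) h) +
          ((-1 : ℤ) ^ 1) • dcH k A ρM ρN 1 p (x 1 p (by omega)) = 0 :=
        congrFun (congrFun (congrFun hx 1) (p + 1)) (by omega)
      rwa [pow_one, neg_one_smul, ← sub_eq_add_neg, sub_eq_zero] at this
    have hcol := colHtpy_dcH hs₁ hs₂ (ρM := ρM) 0 p (x 0 (p + 1) h)
    rw [hx₀, map_zero, eq_comm, sub_eq_zero] at hcol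
    have hrow := rowHtpy_dmH_zero ht₁ ωN (p + 1) (x 0 (p + 1) h)
    rw [hx₁, rowHtpy_dcH ht₃] at hrow
    have hy : dcH k A ρM ρN 0 p (y 0 p (by omega)) =
        ((-1 : ℤ) ^ 1) • dcH k A ρM ρN 0 p (rowHtpy t 0 p (x 1 p (by omega))) +
          dcH k A ρM ρN 0 p (average t ωN p (colHtpy s 0 p (x 0 (p + 1) h))) := by
      refine (map_add (dcHom ρM ρN 0 p) _ _).trans ?_
      rw [map_zsmul]
      rfl
    change 0 + ((-1 : ℤ) ^ 0) • dcH k A ρM ρN 0 p (y 0 p (by omega)) = _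
    rw [hy, hrow, dcH_average ht₃ hN, ← hcol, pow_zero, one_smul, pow_one, neg_one_smul]
    abel
  | n + 1, 0, h =>
    have hx₁ : dmH k A ωM ωN (n + 1) 0 (x (n + 1) 0 h) = 0 := by
      have : dmH k A ωM ωN (n + 1) 0 (x (n + 1) 0 h) + 0 = 0 :=
        congrFun (congrFun (congrFun hx (n + 2)) 0) (by omega)
      rwa [add_zero] at this
    have hrow := rowHtpy_dmH_succ ht₁ ht₂ ωN n 0 (x (n + 1) 0 h)
    rw [hx₁, map_zero, eq_comm, add_eq_zero_iff_eq_neg] at hrow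
    change dmH k A ωM ωN n 0 (y n 0 (by omega)) + 0 = _
    rw [add_zero, hdm, hrow, smul_neg, smul_smul, ← pow_add, ← neg_smul,
      (by rw [Odd.neg_one_pow ⟨n, by ring⟩, neg_neg] : -(-1 : ℤ) ^ (n + 1 + n) = 1), one_smul]
  | n + 1, p + 1, h =>
    have hx₁ : dmH k A ωM ωN (n + 1) (p + 1) (x (n + 1) (p + 1) h) =
        -(((-1 : ℤ) ^ (n + 2)) • dcH k A ρM ρN (n + 2) p (x (n + 2) p (by omega))) := by
      have : dmH k A ωM ωN (n + 1) (p + 1) (x (n + 1) (p + 1) h) +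
          ((-1 : ℤ) ^ (n + 2)) • dcH k A ρM ρN (n + 2) p (x (n + 2) p (by omega)) = 0 :=
        congrFun (congrFun (congrFun hx (n + 2)) (p + 1)) (by omega)
      rwa [add_eq_zero_iff_eq_neg] at this
    have hrow := rowHtpy_dmH_succ ht₁ ht₂ ωN n (p + 1) (x (n + 1) (p + 1) h)
    rw [hx₁, map_neg, map_zsmul, rowHtpy_dcH ht₃, ← sub_eq_iff_eq_add] at hrow
    change dmH k A ωM ωN n (p + 1) (y n (p + 1) (by omega)) +
      ((-1 : ℤ) ^ (n + 1)) • dcH k A ρM ρN (n + 1) p (y (n + 1) p (by omega)) = _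
    rw [hdm, ← hrow, hdc n p (by omega)]
    rcases neg_one_pow_eq_or ℤ n with hn | hn <;> simp [pow_succ, hn]

end PS
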